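/- For a generic endomorphism f of ℂⁿ (n ≥ 1): clo(f) = Ω_f = closure(att(f)) = J_f ∪ att(f). Moreover, J_f = ℂⁿ \ rne(f) and J_f has empty interior. (Proposition 2.13 of the paper, proved for Oka-Stein manifolds; specialized to ℂⁿ.) -/

import Mathlib

open Function Topology Filter Metric

noncomputable section

/-- `ℂⁿ` as a Euclidean space. -/
abbrev Cn (n : ℕ) := EuclideanSpace ℂ (Fin n)

/-- The space `End(ℂⁿ)` of holomorphic self-maps of `ℂⁿ`, topologized as a subspace of
the continuous maps `C(ℂⁿ, ℂⁿ)` with the compact-open topology. -/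
abbrev Endo (n : ℕ) := {f : C(Cn n, Cn n) // Differentiable ℂ ⇑f}

variable {n : ℕ}

/-- The underlying function of an endomorphism. -/
def eapp (f : Endo n) : Cn n → Cn n := ⇑f.1

/-- `p` is a periodic point of `f`. -/
def IsPer (f : Endo n) (p : Cn n) : Prop := ∃ m, 1 ≤ m ∧ (eapp f)^[m] p = p

/-- The minimal period of a periodic point. -/
def minPer (f : Endo n) (p : Cn n) : ℕ := Function.minimalPeriod (eapp f) p

/-- The eigenvalues at a periodic point `p`: the spectrum of the derivative of the
`minPer f p`-th iterate at `p`. -/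
def eigs (f : Endo n) (p : Cn n) : Set ℂ := spectrum ℂ (fderiv ℂ ((eapp f)^[minPer f p]) p)

/-- Hyperbolic periodic point: no eigenvalue of absolute value 1. -/
def IsHypPer (f : Endo n) (p : Cn n) : Prop := IsPer f p ∧ ∀ z ∈ eigs f p, ‖z‖ ≠ 1

/-- Attracting periodic point: all eigenvalues of absolute value < 1. -/
def IsAttPer (f : Endo n) (p : Cn n) : Prop := IsPer f p ∧ ∀ z ∈ eigs f p, ‖z‖ < 1

/-- Repelling periodic point: all eigenvalues of absolute value > 1. -/
def IsRepPer (f : Endo n) (p : Cn n) : Prop := IsPer f p ∧ ∀ z ∈ eigs f p, 1 < ‖z‖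

/-- Saddle periodic point: hyperbolic with eigenvalues of absolute value both < 1 and > 1. -/
def IsSadPer (f : Endo n) (p : Cn n) : Prop :=
  IsHypPer f p ∧ (∃ z ∈ eigs f p, ‖z‖ < 1) ∧ (∃ z ∈ eigs f p, 1 < ‖z‖)

/-- Super-attracting periodic point: the derivative of the `minPer`-th iterate vanishes. -/
def IsSuperAttPer (f : Endo n) (p : Cn n) : Prop :=
  IsPer f p ∧ fderiv ℂ ((eapp f)^[minPer f p]) p = 0

/-- The set of attracting periodic points of `f`. -/
def attSet (f : Endo n) : Set (Cn n) := {p | IsAttPer f p}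

/-- The set of repelling periodic points of `f`. -/
def repSet (f : Endo n) : Set (Cn n) := {p | IsRepPer f p}

/-- The set of saddle periodic points of `f`. -/
def sadSet (f : Endo n) : Set (Cn n) := {p | IsSadPer f p}

/-- The robustly non-expelling set of `f`. -/
def rne (f : Endo n) : Set (Cn n) :=
  {p | ∃ U : Set (Cn n), IsOpen U ∧ p ∈ U ∧ ∃ V ∈ 𝓝 f, ∃ K : Set (Cn n),
        IsCompact K ∧ ∀ g ∈ V, ∀ j : ℕ, (eapp g)^[j] '' U ⊆ K}

/-- A sequence of maps diverges locally uniformly to infinity on `U`. -/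
def DivLocUnifOn (F : ℕ → Cn n → Cn n) (U : Set (Cn n)) : Prop :=
  ∀ L ⊆ U, IsCompact L → ∀ K : Set (Cn n), IsCompact K →
    ∀ᶠ j in atTop, Disjoint (F j '' L) K

/-- `p` belongs to the Fatou set of `f`: the iterates form a normal family near `p`. -/
def FatouAt (f : Endo n) (p : Cn n) : Prop :=
  ∃ U : Set (Cn n), IsOpen U ∧ p ∈ U ∧
    ∀ k : ℕ → ℕ, StrictMono k → ∃ l : ℕ → ℕ, StrictMono l ∧
      ((∃ g : Cn n → Cn n, DifferentiableOn ℂ g U ∧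
          TendstoLocallyUniformlyOn (fun j => (eapp f)^[k (l j)]) g atTop U) ∨
        DivLocUnifOn (fun j => (eapp f)^[k (l j)]) U)

/-- The Fatou set of `f`. -/
def Fatou (f : Endo n) : Set (Cn n) := {p | FatouAt f p}

/-- The Julia set of `f`. -/
def Julia (f : Endo n) : Set (Cn n) := (Fatou f)ᶜ

/-- The cycle (finite orbit) of a periodic point `p`. -/
def cycleOf (f : Endo n) (p : Cn n) : Set (Cn n) := {x | ∃ i < minPer f p, (eapp f)^[i] p = x}

/-- The basin of attraction of the cycle of `p`. -/
def basinOf (f : Endo n) (p : Cn n) : Set (Cn n) :=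
  {x | ∃ a ∈ cycleOf f p, Tendsto (fun k => (eapp f)^[minPer f p * k] x) atTop (𝓝 a)}

/-- The non-wandering set of `f`. -/
def nonWandering (f : Endo n) : Set (Cn n) :=
  {p | ∀ U ∈ 𝓝 p, ∃ k, 1 ≤ k ∧ (U ∩ (eapp f)^[k] '' U).Nonempty}

/-- The set of points whose orbit can be closed in the weak sense. -/
def cloSet (f : Endo n) : Set (Cn n) :=
  {p | ∀ U ∈ 𝓝 p, ∀ V ∈ 𝓝 f, ∃ g ∈ V, ∃ q ∈ U, IsPer g q}

/-- `𝒯(m,K)`: endomorphisms all of whose periodic points in `K` of minimal period at most `m`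
are transverse. -/
def TransSet (n : ℕ) (m : ℕ) (K : Set (Cn n)) : Set (Endo n) :=
  {f | ∀ p ∈ K, IsPer f p → minPer f p ≤ m → (1 : ℂ) ∉ eigs f p}

/-- `ℋ(m,K)`: endomorphisms all of whose periodic points in `K` of minimal period at most `m`
are hyperbolic. -/
def HypSet (n : ℕ) (m : ℕ) (K : Set (Cn n)) : Set (Endo n) :=
  {f | ∀ p ∈ K, IsPer f p → minPer f p ≤ m → ∀ z ∈ eigs f p, ‖z‖ ≠ 1}

/-- The `m`-th iterate of an endomorphism as an endomorphism. -/
def iterEndo (f : Endo n) (m : ℕ) : Endo n :=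
  ⟨⟨(eapp f)^[m], f.1.continuous.iterate m⟩, f.2.iterate m⟩

/-- The set of points with relatively compact forward orbit. -/
def boundedOrb (f : Endo n) : Set (Cn n) :=
  {p | ∃ K : Set (Cn n), IsCompact K ∧ ∀ k : ℕ, (eapp f)^[k] p ∈ K}

/-- An `ε`-chain (pseudo-orbit) of `f` from `x` to `y`. -/
def EpsChain (f : Endo n) (ε : Cn n → ℝ) (x y : Cn n) : Prop :=
  ∃ N : ℕ, 1 ≤ N ∧ ∃ c : ℕ → Cn n, c 0 = x ∧ c N = y ∧
    ∀ j < N, dist (eapp f (c j)) (c (j + 1)) < ε (eapp f (c j))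

/-- `x` and `y` are chain-equivalent for `f`. -/
def ChainEquiv (f : Endo n) (x y : Cn n) : Prop :=
  ∀ ε : Cn n → ℝ, Continuous ε → (∀ z, 0 < ε z) → EpsChain f ε x y ∧ EpsChain f ε y x

/-- `x` is chain-recurrent for `f`. -/
def ChainRec (f : Endo n) (x : Cn n) : Prop :=
  ∀ ε : Cn n → ℝ, Continuous ε → (∀ z, 0 < ε z) → EpsChain f ε x x

/-- Attracting fixed point. -/
def IsAttFix (f : Endo n) (p : Cn n) : Prop :=
  eapp f p = p ∧ ∀ z ∈ spectrum ℂ (fderiv ℂ (eapp f) p), ‖z‖ < 1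

/-- Repelling fixed point. -/
def IsRepFix (f : Endo n) (p : Cn n) : Prop :=
  eapp f p = p ∧ ∀ z ∈ spectrum ℂ (fderiv ℂ (eapp f) p), 1 < ‖z‖

/-- Saddle fixed point. -/
def IsSadFix (f : Endo n) (p : Cn n) : Prop :=
  eapp f p = p ∧ (∀ z ∈ spectrum ℂ (fderiv ℂ (eapp f) p), ‖z‖ ≠ 1) ∧
    (∃ z ∈ spectrum ℂ (fderiv ℂ (eapp f) p), ‖z‖ < 1) ∧
    (∃ z ∈ spectrum ℂ (fderiv ℂ (eapp f) p), 1 < ‖z‖)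

/-- `f` is a local biholomorphism at `p`: `f` agrees near `p` with a homeomorphism onto an
open set whose inverse is holomorphic. -/
def LocalBiholoAt (f : Endo n) (p : Cn n) : Prop :=
  ∃ φ : PartialHomeomorph (Cn n) (Cn n), p ∈ φ.source ∧ Set.EqOn (eapp f) φ φ.source ∧
    DifferentiableOn ℂ φ.symm φ.target

/-! ### Basic facts -/

def StrongAtt (f : Endo n) (p : Cn n) : Prop :=
  ∃ M, 1 ≤ M ∧ (eapp f)^[M] p = p ∧ ‖fderiv ℂ ((eapp f)^[M]) p‖ < 1

lemma eapp_diff (f : Endo n) : Differentiable ℂ (eapp f) := f.2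
lemma eapp_cont (f : Endo n) : Continuous (eapp f) := f.1.continuous
lemma iter_diff (f : Endo n) (j : ℕ) : Differentiable ℂ ((eapp f)^[j]) := (eapp_diff f).iterate j
lemma iter_cont (f : Endo n) (j : ℕ) : Continuous ((eapp f)^[j]) := (eapp_cont f).iterate j

lemma continuous_iterEndo (m : ℕ) : Continuous (fun f : Endo n => (iterEndo f m).1) := by
  induction m with
  | zero =>
    have : (fun f : Endo n => (iterEndo f 0).1) = fun _ => ContinuousMap.id (Cn n) := by
      funext f; ext x; rfl
    rw [this]; exact continuous_const
  | succ m ih =>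
    have : (fun f : Endo n => (iterEndo f (m+1)).1) = fun f => f.1.comp (iterEndo f m).1 := by
      funext f; apply ContinuousMap.ext; intro x
      exact Function.iterate_succ_apply' (eapp f) m x
    rw [this]
    exact continuous_subtype_val.compCM ih

/-- uniform closeness of iterates on compacts. -/
lemma iter_close (f : Endo n) (m : ℕ) {K : Set (Cn n)} (hK : IsCompact K) {ε : ℝ} (hε : 0 < ε) :
    ∀ᶠ g in 𝓝 f, ∀ x ∈ K, dist ((eapp f)^[m] x) ((eapp g)^[m] x) < ε := by
  have h := (continuous_iterEndo (n := n) m).tendsto f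
  rw [ContinuousMap.tendsto_iff_forall_isCompact_tendstoUniformlyOn] at h
  exact Metric.tendstoUniformlyOn_iff.1 (h K hK) ε hε

lemma nhds_basis_endo (f : Endo n) {V : Set (Endo n)} (hV : V ∈ 𝓝 f) :
    ∃ N : ℝ, ∃ ε > 0, ∀ g : Endo n, (∀ x ∈ closedBall (0 : Cn n) N,
      dist (eapp f x) (eapp g x) < ε) → g ∈ V := by
  have hV := mem_nhds_induced (Subtype.val : Endo n → C(Cn n, Cn n)) f V |>.1 hV
  obtain ⟨W, hW, hWV⟩ := hV
  rw [UniformSpace.mem_nhds_iff] at hW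
  obtain ⟨S, hS, hSW⟩ := hW
  rw [(Metric.uniformity_basis_dist.compactConvergenceUniformity).mem_iff] at hS
  obtain ⟨⟨K, ε⟩, ⟨hK, hε⟩, hsub⟩ := hS
  obtain ⟨N, hN⟩ := hK.isBounded.subset_closedBall 0
  refine ⟨N, ε, hε, fun g hg => hWV (hSW (hsub ?_))⟩
  intro x hx
  exact hg x (hN hx)

lemma schwarz_bounds {F : Cn n → Cn n} (hF : Differentiable ℂ F) {x : Cn n} {r C : ℝ} (hr : 0 < r)
    (hb : ∀ y ∈ ball x r, ‖F y‖ ≤ C) :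
    ‖fderiv ℂ F x‖ ≤ 2 * C / r ∧ (∀ y ∈ ball x r, ‖F y - F x‖ ≤ 2 * C / r * ‖y - x‖) ∧
    ∀ y ∈ ball x r, ‖F y - F x - fderiv ℂ F x (y - x)‖ ≤ 4 * C / r ^ 2 * ‖y - x‖ ^ 2 := by
  have hx : ‖F x‖ ≤ C := hb x (mem_ball_self hr)
  have h1 : Set.MapsTo F (ball x r) (closedBall (F x) (2 * C)) := by
    intro y hy
    rw [mem_closedBall, dist_eq_norm]
    calc _ ≤ ‖F y‖ + ‖F x‖ := norm_sub_le _ _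
      _ ≤ _ := by linarith [hb y hy]
  have hd := Complex.norm_fderiv_le_div_of_mapsTo_ball hF.differentiableOn h1 hr
  have hl : ∀ y ∈ ball x r, ‖F y - F x‖ ≤ 2 * C / r * ‖y - x‖ := fun y hy => by
    simpa [dist_eq_norm] using
      Complex.dist_le_div_mul_dist_of_mapsTo_ball hF.differentiableOn h1 hy
  refine ⟨hd, hl, fun y hy => ?_⟩
  have hC : 0 ≤ C := (norm_nonneg _).trans hx
  set G : Cn n → Cn n := fun y => F y - F x - fderiv ℂ F x (y - x) with hG
  have hGx : G x = 0 := by simp [hG]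
  have hGd : Differentiable ℂ G := by
    intro z
    have := hF z
    fun_prop
  have hm : Set.MapsTo G (ball x r) (closedBall (G x) (4 * C)) := by
    intro z hz
    rw [hGx, mem_closedBall, dist_zero_right]
    have hz' : ‖z - x‖ < r := by simpa [dist_eq_norm] using hz
    calc ‖G z‖ ≤ ‖F z - F x‖ + ‖fderiv ℂ F x (z - x)‖ := norm_sub_le _ _
      _ ≤ 2 * C / r * ‖z - x‖ + 2 * C / r * ‖z - x‖ := by
        gcongr
        · exact hl z hz
        · exact (ContinuousLinearMap.le_opNorm _ _).trans (by gcongr)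
      _ ≤ 2 * C / r * r + 2 * C / r * r := by gcongr
      _ = 4 * C := by field_simp; ring
  have ho : (G · - G x) =o[𝓝 x] (fun w ↦ ‖w - x‖ ^ 1) := by
    simp only [hGx, sub_zero, pow_one]
    exact ((hF x).hasFDerivAt.isLittleO).norm_right
  have := Complex.dist_le_mul_div_pow_of_mapsTo_ball_of_isLittleO hGd.differentiableOn hm ho hy
  rw [hGx, dist_zero_right] at this
  refine this.trans (le_of_eq ?_)
  rw [dist_eq_norm, div_pow]; field_simp; ring

/-- robustly bounded on ball. -/
lemma rne_ball {f : Endo n} {p : Cn n} (hp : p ∈ rne f) :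
    ∃ R > 0, ∃ C > 0, ∃ V ∈ 𝓝 f, ∀ g ∈ V, ∀ j : ℕ, ∀ y ∈ ball p R, ‖(eapp g)^[j] y‖ ≤ C := by
  obtain ⟨U, hU, hpU, V, hV, K, hK, h⟩ := hp
  obtain ⟨R, hR, hRU⟩ := Metric.isOpen_iff.1 hU p hpU
  obtain ⟨C, hC0, hC⟩ := hK.isBounded.exists_pos_norm_le
  exact ⟨R, hR, C, hC0, V, hV, fun g hg j y hy =>
    hC _ (h g hg j (Set.mem_image_of_mem _ (hRU hy)))⟩

lemma rne_of_ball {f : Endo n} {p : Cn n} {R C : ℝ} (hR : 0 < R) {V : Set (Endo n)} (hV : V ∈ 𝓝 f)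
    (h : ∀ g ∈ V, ∀ j : ℕ, ∀ y ∈ ball p R, ‖(eapp g)^[j] y‖ ≤ C) : p ∈ rne f := by
  refine ⟨ball p R, isOpen_ball, mem_ball_self hR, V, hV, closedBall 0 C,
    isCompact_closedBall _ _, fun g hg j => ?_⟩
  rintro _ ⟨y, hy, rfl⟩
  simpa using h g hg j y hy

lemma fderiv_iter_mul (f : Endo n) {p : Cn n} {m : ℕ} (hm : (eapp f)^[m] p = p) (k : ℕ) :
    fderiv ℂ ((eapp f)^[m * k]) p = (fderiv ℂ ((eapp f)^[m]) p) ^ k := by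
  rw [Function.iterate_mul]
  exact ((iter_diff f m p).hasFDerivAt.iterate hm k).fderiv

lemma StrongAtt.isAtt {f : Endo n} {p : Cn n} (h : StrongAtt f p) : IsAttPer f p := by
  obtain ⟨M, hM, hp, hn⟩ := h
  refine ⟨⟨M, hM, hp⟩, fun z hz => ?_⟩
  have hmp : (eapp f)^[minPer f p] p = p := Function.iterate_minimalPeriod
  obtain ⟨k, hk⟩ : minPer f p ∣ M := Function.IsPeriodicPt.minimalPeriod_dvd hp
  rw [hk, fderiv_iter_mul f hmp k] at hn
  have hz' : z ^ k ∈ spectrum ℂ ((fderiv ℂ ((eapp f)^[minPer f p]) p) ^ k) :=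
    spectrum.pow_mem_pow _ k hz
  have h2 : ‖z ^ k‖ < 1 := by
    rcases subsingleton_or_nontrivial (Cn n) with hs | hs
    · exfalso
      have : Subsingleton (Cn n →L[ℂ] Cn n) := ⟨fun a b => by exact ContinuousLinearMap.ext fun x => Subsingleton.elim (a x) (b x)⟩
      rw [eigs, spectrum.of_subsingleton] at hz
      exact hz
    · exact (spectrum.norm_le_norm_of_mem hz').trans_lt hn
  by_contra hc
  rw [norm_pow] at h2
  exact absurd (one_le_pow₀ (not_lt.1 hc)) (not_le.2 h2)
/-! ### Strongly attracting points -/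

lemma StrongAtt.trap {f : Endo n} {p : Cn n} (h : StrongAtt f p) {δ : ℝ} (hδ : 0 < δ) :
    ∃ M, 1 ≤ M ∧ ∃ r > 0, r ≤ δ ∧ ∀ y ∈ closedBall p r, ‖(eapp f)^[M] y - p‖ ≤ r / 16 := by
  obtain ⟨M, hM, hp, hn⟩ := h
  set A := fderiv ℂ ((eapp f)^[M]) p with hA
  have ht : Tendsto (fun k : ℕ => ‖A‖ ^ k) atTop (𝓝 0) :=
    tendsto_pow_atTop_nhds_zero_of_lt_one (norm_nonneg _) hn
  obtain ⟨k, hk, hk1⟩ := ((ht.eventually (gt_mem_nhds (by norm_num : (0:ℝ) < 1/32))).and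
    (eventually_ge_atTop 1)).exists
  have hAk : ‖A ^ k‖ ≤ 1/32 := (norm_pow_le' A hk1).trans hk.le
  have hpk : (eapp f)^[M * k] p = p := by
    rw [Function.iterate_mul]; exact Function.iterate_fixed hp k
  have hd : HasFDerivAt ((eapp f)^[M * k]) (A ^ k) p := by
    rw [hA, ← fderiv_iter_mul f hp k]; exact (iter_diff f _ p).hasFDerivAt
  have ho := hd.isLittleO.def (by norm_num : (0:ℝ) < 1/32)
  obtain ⟨s, hs, hsb⟩ := Metric.eventually_nhds_iff_ball.1 ho
  refine ⟨M * k, Nat.mul_pos hM hk1, min δ (s/2), by positivity, min_le_left _ _, fun y hy => ?_⟩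
  have hy' : ‖y - p‖ ≤ min δ (s/2) := by simpa [dist_eq_norm] using hy
  have hyb : y ∈ ball p s := by
    rw [mem_ball, dist_eq_norm]
    exact hy'.trans_lt ((min_le_right _ _).trans_lt (by linarith))
  have h1 := hsb y hyb
  rw [hpk] at h1
  have h2 : ‖(A ^ k) (y - p)‖ ≤ 1/32 * ‖y - p‖ :=
    (ContinuousLinearMap.le_opNorm _ _).trans (by gcongr)
  calc ‖(eapp f)^[M * k] y - p‖
      = ‖((eapp f)^[M * k] y - p - (A ^ k) (y - p)) + (A ^ k) (y - p)‖ := by congr 1; abel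
    _ ≤ _ := norm_add_le _ _
    _ ≤ 1/32 * ‖y - p‖ + 1/32 * ‖y - p‖ := add_le_add h1 h2
    _ ≤ _ := by linarith

lemma trap_maps {f : Endo n} {p : Cn n} {M : ℕ} {r : ℝ} (hr : 0 < r)
    (h : ∀ y ∈ closedBall p r, ‖(eapp f)^[M] y - p‖ ≤ r / 16) :
    ∀ᶠ g in 𝓝 f, ∀ y ∈ closedBall p r, (eapp g)^[M] y ∈ closedBall p (r / 8) := by
  filter_upwards [iter_close f M (isCompact_closedBall p r) (by positivity : 0 < r / 16)]
    with g hg y hy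
  rw [mem_closedBall]
  have h1 := hg y hy
  have h2 := h y hy
  rw [← dist_eq_norm] at h2
  rw [dist_comm] at h1
  linarith [dist_triangle ((eapp g)^[M] y) ((eapp f)^[M] y) p]

lemma StrongAtt.robust {f : Endo n} {p : Cn n} (h : StrongAtt f p) {U : Set (Cn n)}
    (hU : U ∈ 𝓝 p) : ∀ᶠ g in 𝓝 f, ∃ q ∈ U, StrongAtt g q := by
  obtain ⟨δ, hδ, hδU⟩ := Metric.nhds_basis_closedBall.mem_iff.1 hU
  obtain ⟨M, hM, r, hr, hrδ, htr⟩ := h.trap hδ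
  filter_upwards [trap_maps hr htr] with g hg
  set G := (eapp g)^[M] with hG
  have hGd : Differentiable ℂ G := iter_diff g M
  have hmaps : ∀ y ∈ closedBall p (r/8), Set.MapsTo G (ball y (r/2)) (closedBall (G y) (r/4)) := by
    intro y hy z hz
    rw [mem_closedBall] at hy ⊢
    rw [mem_ball] at hz
    have h1 := hg z (by rw [mem_closedBall]; linarith [dist_triangle z y p])
    have h2 := hg y (by rw [mem_closedBall]; linarith)
    rw [mem_closedBall] at h1 h2
    linarith [dist_triangle_right (G z) (G y) p]
  have hself : Set.MapsTo G (closedBall p (r/8)) (closedBall p (r/8)) := fun y hy =>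
    hg y (closedBall_subset_closedBall (by linarith) hy)
  have hc : ContractingWith (1/2) (hself.restrict G _ _) := by
    refine ⟨by norm_num, LipschitzWith.of_dist_le_mul fun x y => ?_⟩
    have hx := x.2
    have hy := y.2
    rw [mem_closedBall] at hx hy
    have := Complex.dist_le_div_mul_dist_of_mapsTo_ball hGd.differentiableOn (hmaps y y.2)
      (z := (x : Cn n)) (by
        rw [mem_ball]
        linarith [dist_triangle_right (x : Cn n) y p])
    have he : r / 4 / (r / 2) = ((1/2 : NNReal) : ℝ) := by push_cast; field_simp; norm_num
    rw [he] at this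
    exact this
  obtain ⟨q, hq, hfix, -⟩ := hc.exists_fixedPoint' isClosed_closedBall.isComplete hself
    (mem_closedBall_self (by positivity)) (edist_ne_top p (G p))
  refine ⟨q, hδU (closedBall_subset_closedBall (by linarith) hq), M, hM, hfix, ?_⟩
  have := Complex.norm_fderiv_le_div_of_mapsTo_ball hGd.differentiableOn (hmaps q hq) (by positivity)
  refine this.trans_lt ?_
  rw [div_lt_one (by positivity)]; linarith

lemma StrongAtt.mem_rne {f : Endo n} {p : Cn n} (h : StrongAtt f p) : p ∈ rne f := by
  obtain ⟨M, hM, r, hr, -, htr⟩ := h.trap one_pos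
  have hB : ∃ C, ∀ i < M, ∀ y ∈ closedBall p r, ‖(eapp f)^[i] y‖ ≤ C := by
    have : ∀ i, ∃ C, ∀ y ∈ closedBall p r, ‖(eapp f)^[i] y‖ ≤ C := fun i =>
      (isCompact_closedBall p r).exists_bound_of_continuousOn (iter_cont f i).continuousOn
    choose C hC using this
    refine ⟨∑ i ∈ Finset.range M, |C i|, fun i hi y hy => (hC i y hy).trans ?_⟩
    exact (le_abs_self _).trans
      (Finset.single_le_sum (f := fun i => |C i|) (fun _ _ => abs_nonneg _) (Finset.mem_range.2 hi))
  obtain ⟨C, hC⟩ := hB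
  have h2 : ∀ᶠ g in 𝓝 f, ∀ i < M, ∀ y ∈ closedBall p r, ‖(eapp g)^[i] y‖ ≤ C + 1 := by
    have : ∀ᶠ g in 𝓝 f, ∀ i ∈ Finset.range M, ∀ y ∈ closedBall p r, ‖(eapp g)^[i] y‖ ≤ C + 1 := by
      rw [Filter.eventually_all_finset]
      intro i hi
      filter_upwards [iter_close f i (isCompact_closedBall p r) one_pos] with g hg y hy
      have h1 := hg y hy
      have h3 := hC i (Finset.mem_range.1 hi) y hy
      rw [dist_eq_norm, norm_sub_rev] at h1
      linarith [norm_le_norm_add_norm_sub' ((eapp g)^[i] y) ((eapp f)^[i] y)]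
    filter_upwards [this] with g hg i hi
    exact hg i (Finset.mem_range.2 hi)
  refine rne_of_ball (C := C + 1) hr ((trap_maps hr htr).and h2) ?_
  rintro g ⟨hg1, hg2⟩ j y hy
  have hinv : ∀ a : ℕ, ((eapp g)^[M])^[a] y ∈ closedBall p r := by
    intro a
    induction a with
    | zero => exact ball_subset_closedBall hy
    | succ a ih =>
      rw [Function.iterate_succ_apply']
      exact closedBall_subset_closedBall (by linarith) (hg1 _ ih)
  have : (eapp g)^[j] y = (eapp g)^[j % M] (((eapp g)^[M])^[j / M] y) := by
    rw [← Function.iterate_mul, ← Function.iterate_add_apply, Nat.mod_add_div]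
  rw [this]
  exact hg2 _ (Nat.mod_lt _ hM) _ (hinv _)

/-! ### Escape perturbation -/

def mkE (F : Cn n → Cn n) (hF : Differentiable ℂ F) : Endo n := ⟨⟨F, hF.continuous⟩, hF⟩

lemma eapp_mkE (F : Cn n → Cn n) (hF : Differentiable ℂ F) : eapp (mkE F hF) = F := rfl

lemma exists_interp (k : ℕ) (q : ℕ → Cn n) (w : Cn n) (h : ∀ j < k, q j ≠ w) :
    ∃ P : Cn n → ℂ, Differentiable ℂ P ∧ P w = 1 ∧ ∀ j < k, P (q j) = 0 := by
  refine ⟨fun z => ∏ j ∈ Finset.range k,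
    (innerSL ℂ (w - q j) (z - q j) / (((‖w - q j‖ : ℝ) : ℂ) ^ 2)), ?_, ?_, ?_⟩
  · induction k with
    | zero => simp
    | succ k ih =>
      simp only [Finset.prod_range_succ]
      have := ih (fun j hj => h j (by omega))
      fun_prop
  · apply Finset.prod_eq_one
    intro j hj
    have : w - q j ≠ 0 := sub_ne_zero.2 (h j (Finset.mem_range.1 hj)).symm
    have h2 : (((‖w - q j‖ : ℝ) : ℂ) ^ 2) ≠ 0 := by
      simpa using this
    rw [innerSL_apply_apply, inner_self_eq_norm_sq_to_K]
    exact div_self h2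
  · intro j hj
    apply Finset.prod_eq_zero (Finset.mem_range.2 hj)
    simp

lemma exists_cutoff (k : ℕ) (q : ℕ → Cn n) (w : Cn n) {N : ℝ} (h : ∀ j < k, ‖q j‖ ≤ N)
    (hN : 0 ≤ N) (hw : N < ‖w‖) {η : ℝ} (hη : 0 < η) :
    ∃ ψ : Cn n → ℂ, Differentiable ℂ ψ ∧ ψ w = 1 ∧ (∀ j < k, ψ (q j) = 0) ∧
      HasFDerivAt ψ (0 : Cn n →L[ℂ] ℂ) w ∧ ∀ z ∈ closedBall (0 : Cn n) N, ‖ψ z‖ ≤ η := by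
  obtain ⟨P, hP, hPw, hPq⟩ := exists_interp k q w (fun j hj e => by
    have := h j hj; rw [e] at this; linarith)
  obtain ⟨B, hB⟩ := (isCompact_closedBall (0 : Cn n) N).exists_bound_of_continuousOn
    hP.continuous.continuousOn
  have hw0 : 0 < ‖w‖ := hN.trans_lt hw
  set θ : ℝ := N / ‖w‖ with hθ
  have hθ0 : 0 ≤ θ := by positivity
  have hθ1 : θ < 1 := (div_lt_one hw0).2 hw
  have hlim : Tendsto (fun m : ℕ => θ ^ m * B) atTop (𝓝 0) := by
    simpa using (tendsto_pow_atTop_nhds_zero_of_lt_one hθ0 hθ1).mul_const B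
  obtain ⟨m, hm⟩ := (hlim.eventually (gt_mem_nhds (show (0:ℝ) < min 1 (η / 3) by positivity))).exists
  set ℓ : Cn n → ℂ := fun z => innerSL ℂ w z / (((‖w‖ : ℝ) : ℂ) ^ 2) with hℓ
  have hℓd : Differentiable ℂ ℓ := by fun_prop
  have hℓw : ℓ w = 1 := by
    have h2 : (((‖w‖ : ℝ) : ℂ) ^ 2) ≠ 0 := by
      simpa using hw0.ne'
    simp only [hℓ]
    rw [innerSL_apply_apply, inner_self_eq_norm_sq_to_K]
    exact div_self h2
  have hℓb : ∀ z ∈ closedBall (0 : Cn n) N, ‖ℓ z‖ ≤ θ := by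
    intro z hz
    have hz : ‖z‖ ≤ N := by simpa using hz
    simp only [hℓ]
    rw [innerSL_apply_apply, norm_div, norm_pow, Complex.norm_real, norm_norm, hθ,
      div_le_div_iff₀ (by positivity) hw0]
    calc ‖inner ℂ w z‖ * ‖w‖ ≤ (‖w‖ * ‖z‖) * ‖w‖ := by gcongr; exact norm_inner_le_norm _ _
      _ ≤ (‖w‖ * N) * ‖w‖ := by gcongr
      _ = _ := by ring
  set u : Cn n → ℂ := fun z => ℓ z ^ m * P z with hu
  have hud : Differentiable ℂ u := by fun_prop
  have huw : u w = 1 := by simp [hu, hℓw, hPw]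
  refine ⟨fun z => u z * (2 - u z), by fun_prop, by simp [huw]; norm_num, ?_, ?_, ?_⟩
  · intro j hj
    simp [hu, hPq j hj]
  · have h1 := (hud w).hasFDerivAt
    have h2 := h1.mul ((hasFDerivAt_const (2:ℂ) w).sub h1)
    refine h2.congr_fderiv ?_
    ext v
    simp [huw]
    ring
  · intro z hz
    have h1 : ‖u z‖ ≤ θ ^ m * B := by
      simp only [hu, norm_mul, norm_pow]
      gcongr
      · exact hℓb z hz
      · exact hB z hz
    have h2 : ‖u z‖ < 1 := (h1.trans_lt hm).trans_le (min_le_left _ _)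
    have h3 : ‖u z‖ < η / 3 := (h1.trans_lt hm).trans_le (min_le_right _ _)
    have h4 : ‖(2 : ℂ) - u z‖ ≤ 3 := by
      refine (norm_sub_le _ _).trans ?_
      simp; linarith
    calc ‖u z * (2 - u z)‖ = ‖u z‖ * ‖2 - u z‖ := norm_mul _ _
      _ ≤ (η / 3) * 3 := by gcongr
      _ = η := by ring

lemma escape {f : Endo n} {p : Cn n} (hp : p ∉ rne f) {U : Set (Cn n)} (hU : U ∈ 𝓝 p)
    {V : Set (Endo n)} (hV : V ∈ 𝓝 f) : ∃ g ∈ V, ∃ q ∈ U, StrongAtt g q := by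
  obtain ⟨N₀, ε, hε, hNV⟩ := nhds_basis_endo f hV
  obtain ⟨R, hR, hRU⟩ := Metric.mem_nhds_iff.1 hU
  set N := max N₀ 0
  have hN0 : 0 ≤ N := le_max_right _ _
  have hV' := iter_close f 1 (isCompact_closedBall (0 : Cn n) N) (half_pos hε)
  obtain ⟨g, hg, j₀, x, hx, hj₀⟩ : ∃ g : Endo n, (∀ x ∈ closedBall (0 : Cn n) N,
      dist ((eapp f)^[1] x) ((eapp g)^[1] x) < ε / 2) ∧ ∃ j : ℕ, ∃ x ∈ ball p R,
      N < ‖(eapp g)^[j] x‖ := by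
    by_contra! hc
    exact hp (rne_of_ball hR hV' hc)
  classical
  have hex : ∃ j : ℕ, N < ‖(eapp g)^[j] x‖ := ⟨j₀, hj₀⟩
  set k := Nat.find hex
  set q : ℕ → Cn n := fun j => (eapp g)^[j] x with hq
  have hk : N < ‖q k‖ := Nat.find_spec hex
  have hjk : ∀ j < k, ‖q j‖ ≤ N := fun j hj => not_lt.1 (Nat.find_min hex hj)
  obtain ⟨G, hG⟩ := (isCompact_closedBall (0 : Cn n) N).exists_bound_of_continuousOn
    (eapp_cont g).continuousOn
  have hG0 : 0 ≤ G := (norm_nonneg _).trans (hG 0 (by simpa using hN0))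
  have hD : 0 < ‖x‖ + G + 1 := by positivity
  obtain ⟨ψ, hψ, hψw, hψq, hψd, hψb⟩ := exists_cutoff k q (q k) hjk hN0 hk
    (show 0 < ε / 2 / (‖x‖ + G + 1) / 2 by positivity)
  have hgd := eapp_diff g
  set F : Cn n → Cn n := fun z => eapp g z + ψ z • (x - eapp g z) with hF
  have hFd : Differentiable ℂ F := by
    intro z
    have := hgd z
    have := hψ z
    fun_prop
  have hFj : ∀ j ≤ k, F^[j] x = q j := by
    intro j
    induction j with
    | zero => intro _; rfl
    | succ j ih =>
      intro hj
      rw [Function.iterate_succ_apply', ih (by omega)]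
      have e1 : eapp g (q j) = q (j + 1) := (Function.iterate_succ_apply' _ _ _).symm
      show eapp g (q j) + ψ (q j) • (x - eapp g (q j)) = q (j + 1)
      rw [hψq j (by omega), zero_smul, add_zero, e1]
  have hFk : F^[k+1] x = x := by
    rw [Function.iterate_succ_apply', hFj k le_rfl]
    simp [hF, hψw]
  have hFD : HasFDerivAt F (0 : Cn n →L[ℂ] Cn n) (q k) := by
    have h1 := (hgd (q k)).hasFDerivAt
    have h2 := h1.add (hψd.smul ((hasFDerivAt_const x (q k)).sub h1))
    refine h2.congr_fderiv ?_
    ext v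
    simp [hψw]
  refine ⟨mkE F hFd, hNV _ fun z hz => ?_, x, hRU hx, k+1, by omega, hFk, ?_⟩
  · have hz : z ∈ closedBall (0 : Cn n) N := closedBall_subset_closedBall (le_max_left _ _) hz
    have h1 := hg z hz
    simp only [Function.iterate_one] at h1
    rw [eapp_mkE]
    have h2 : dist (eapp g z) (F z) ≤ ε / 2 / 2 := by
      rw [dist_comm, dist_eq_norm]
      simp only [hF, add_sub_cancel_left, norm_smul]
      calc ‖ψ z‖ * ‖x - eapp g z‖ ≤ (ε / 2 / (‖x‖ + G + 1) / 2) * (‖x‖ + G + 1) := by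
            gcongr
            · exact hψb z hz
            · exact (norm_sub_le _ _).trans (by linarith [hG z hz])
        _ = ε / 2 / 2 := by field_simp
    linarith [dist_triangle (eapp f z) (eapp g z) (F z)]
  · rw [eapp_mkE, Function.iterate_succ']
    have h1 : HasFDerivAt F^[k] (fderiv ℂ F^[k] x) x := ((hFd.iterate k) x).hasFDerivAt
    rw [← hFj k le_rfl] at hFD
    rw [(hFD.comp x h1).fderiv]
    simp

/-! ### Periodic points in the robustly non-expelling set -/

def pert (f : Endo n) (W : Cn n → Cn n) (hW : Differentiable ℂ W) (t : ℂ) : Endo n :=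
  mkE (fun z => eapp f (z + t • W z))
    ((eapp_diff f).comp (differentiable_id.add (hW.const_smul t)))

lemma pert_apply (f : Endo n) (W : Cn n → Cn n) (hW : Differentiable ℂ W) (t : ℂ) (z : Cn n) :
    eapp (pert f W hW t) z = eapp f (z + t • W z) := rfl

lemma pert_close (f : Endo n) (W : Cn n → Cn n) (hW : Differentiable ℂ W) {V : Set (Endo n)}
    (hV : V ∈ 𝓝 f) : ∃ ε > 0, ∀ t : ℂ, ‖t‖ < ε → pert f W hW t ∈ V := by
  obtain ⟨N, ε, hε, hNV⟩ := nhds_basis_endo f hV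
  obtain ⟨B, hB⟩ := (isCompact_closedBall (0 : Cn n) N).exists_bound_of_continuousOn
    hW.continuous.continuousOn
  have hu := (isCompact_closedBall (0 : Cn n) (N + 1)).uniformContinuousOn_of_continuous
    (eapp_cont f).continuousOn
  obtain ⟨δ, hδ, hu⟩ := Metric.uniformContinuousOn_iff.1 hu ε hε
  refine ⟨min δ 1 / (|B| + 1), by positivity, fun t ht => hNV _ fun x hx => ?_⟩
  rw [pert_apply]
  rw [lt_div_iff₀ (by positivity)] at ht
  have hx' : ‖x‖ ≤ N := by simpa using hx
  have h1 : ‖t • W x‖ < min δ 1 := by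
    rw [norm_smul]
    refine lt_of_le_of_lt ?_ ht
    gcongr
    linarith [hB x hx, le_abs_self B]
  have h2 : ‖t • W x‖ < δ := h1.trans_le (min_le_left _ _)
  have h3 : ‖t • W x‖ < 1 := h1.trans_le (min_le_right _ _)
  apply hu
  · simp; linarith
  · simp only [mem_closedBall, dist_zero_right]
    exact (norm_add_le _ _).trans (by linarith)
  · rw [dist_comm, dist_eq_norm]; simpa using h2

lemma per_rne {f : Endo n} {p : Cn n} (hper : IsPer f p) (hp : p ∈ rne f) : StrongAtt f p := by
  obtain ⟨m₀, hm₀, hpm₀⟩ := hper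
  classical
  have hex : ∃ m, 1 ≤ m ∧ (eapp f)^[m] p = p := ⟨m₀, hm₀, hpm₀⟩
  set m := Nat.find hex
  obtain ⟨hm, hpm⟩ : 1 ≤ m ∧ (eapp f)^[m] p = p := Nat.find_spec hex
  have hmin : ∀ j, 1 ≤ j → j < m → (eapp f)^[j] p ≠ p := fun j h1 hj e =>
    Nat.find_min hex hj ⟨h1, e⟩
  obtain ⟨P, hP, hPp, hPj⟩ := exists_interp (m - 1) (fun j => (eapp f)^[j+1] p) p
    (fun j hj => hmin _ (by omega) (by omega))
  set W : Cn n → Cn n := fun z => (P z * P z) • (z - p) with hWdef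
  have hW' : ∀ z, HasFDerivAt W ((P z * P z) • (ContinuousLinearMap.id ℂ (Cn n)) +
      (P z • fderiv ℂ P z + P z • fderiv ℂ P z).smulRight (z - p)) z := by
    intro z
    have h1 := (hP z).hasFDerivAt
    exact (h1.mul h1).smul ((hasFDerivAt_id z).sub_const p)
  have hW : Differentiable ℂ W := fun z => (hW' z).differentiableAt
  have hWp : W p = 0 := by simp [hWdef]
  have hWD : HasFDerivAt W (ContinuousLinearMap.id ℂ (Cn n)) p := by
    refine (hW' p).congr_fderiv ?_
    ext v; simp [hPp]
  have hWj : ∀ j, 1 ≤ j → j < m → W ((eapp f)^[j] p) = 0 := by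
    intro j h1 h2
    have := hPj (j - 1) (by omega)
    rw [show j - 1 + 1 = j by omega] at this
    simp [hWdef, this]
  have hWDj : ∀ j, 1 ≤ j → j < m →
      HasFDerivAt W (0 : Cn n →L[ℂ] Cn n) ((eapp f)^[j] p) := by
    intro j h1 h2
    have := hPj (j - 1) (by omega)
    rw [show j - 1 + 1 = j by omega] at this
    refine (hW' _).congr_fderiv ?_
    ext v; simp [this]
  obtain ⟨R, hR, C, hC, V, hV, hb⟩ := rne_ball hp
  obtain ⟨ε, hε, hεV⟩ := pert_close f W hW hV
  set t : ℝ := ε / 2 with ht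
  have ht0 : 0 < t := by positivity
  set h := pert f W hW (t : ℂ) with hh
  have hhV : h ∈ V := hεV _ (by
    rw [Complex.norm_real, Real.norm_of_nonneg ht0.le]; linarith)
  have hfd := eapp_diff f
  have hD : ∀ z L, HasFDerivAt W L z → W z = 0 → HasFDerivAt (eapp h)
      ((fderiv ℂ (eapp f) z).comp (ContinuousLinearMap.id ℂ (Cn n) + (t : ℂ) • L)) z := by
    intro z L hL h0
    have h1 : HasFDerivAt (fun z => z + (t : ℂ) • W z)
      (ContinuousLinearMap.id ℂ (Cn n) + (t : ℂ) • L) z := (hasFDerivAt_id z).add (hL.fun_const_smul _)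
    have h2 : HasFDerivAt (eapp f) (fderiv ℂ (eapp f) z) (z + (t : ℂ) • W z) := by
      rw [h0, smul_zero, add_zero]; exact (hfd z).hasFDerivAt
    have h3 := HasFDerivAt.comp (f := fun z => z + (t : ℂ) • W z) z h2 h1
    exact h3
  have hval : ∀ z, W z = 0 → eapp h z = eapp f z := by
    intro z hz
    rw [hh, pert_apply, hz, smul_zero, add_zero]
  have key : ∀ i, i + 1 ≤ m → (eapp h)^[i+1] p = (eapp f)^[i+1] p ∧
      HasFDerivAt ((eapp h)^[i+1]) ((1 + (t : ℂ)) • fderiv ℂ ((eapp f)^[i+1]) p) p := by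
    intro i
    induction i with
    | zero =>
      intro _
      simp only [zero_add, Function.iterate_one]
      refine ⟨hval p hWp, (hD p _ hWD hWp).congr_fderiv ?_⟩
      ext v
      simp [add_mul]
    | succ i ih =>
      intro hi
      obtain ⟨h1, h2⟩ := ih (by omega)
      have h3 := hWj (i+1) (by omega) (by omega)
      have h4 := hWDj (i+1) (by omega) (by omega)
      refine ⟨?_, ?_⟩
      · rw [Function.iterate_succ_apply', h1, hval _ h3, ← Function.iterate_succ_apply' (eapp f)]
      · have h5 := hD _ _ h4 h3
        rw [← h1] at h5
        rw [Function.iterate_succ' (eapp h)]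
        refine (h5.comp p h2).congr_fderiv ?_
        rw [Function.iterate_succ' (eapp f) (i+1),
          fderiv_comp p (hfd _) (iter_diff f (i+1) p), h1]
        ext v
        simp
  obtain ⟨k1, k2⟩ := key (m - 1) (by omega)
  rw [show m - 1 + 1 = m by omega] at k1 k2
  rw [hpm] at k1
  set A := fderiv ℂ ((eapp f)^[m]) p with hA
  have hbd : ∀ k : ℕ, (1 + t) ^ k * ‖A ^ k‖ ≤ 2 * C / R := by
    intro k
    have h1 := (schwarz_bounds (iter_diff h (m * k)) hR (hb h hhV (m * k))).1
    rw [fderiv_iter_mul h k1, k2.fderiv, smul_pow, norm_smul, norm_pow] at h1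
    have : ‖(1 + (t : ℂ))‖ = 1 + t := by
      rw [← Complex.ofReal_one, ← Complex.ofReal_add, Complex.norm_real,
        Real.norm_of_nonneg (by linarith)]
    rwa [this] at h1
  obtain ⟨k, hk⟩ := pow_unbounded_of_one_lt (2 * C / R) (show 1 < 1 + t by linarith)
  have hk2 : 2 * C / R < (1 + t) ^ (k + 1) :=
    hk.trans_le (pow_le_pow_right₀ (by linarith) (by omega))
  refine ⟨m * (k+1), by nlinarith, ?_, ?_⟩
  · rw [Function.iterate_mul]; exact Function.iterate_fixed hpm _
  · rw [fderiv_iter_mul f hpm]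
    have h3 := (hbd (k+1)).trans_lt hk2
    by_contra hc
    have : (1 + t) ^ (k + 1) * 1 ≤ (1 + t) ^ (k + 1) * ‖A ^ (k+1)‖ := by
      gcongr; exact not_lt.1 hc
    linarith

/-! ### Recurrent points in the robustly non-expelling set -/

lemma nonWandering_rec {f : Endo n} {p : Cn n} (hw : p ∈ nonWandering f) (hp : p ∈ rne f) :
    ∀ δ > 0, ∃ k, 1 ≤ k ∧ ‖(eapp f)^[k] p - p‖ < δ := by
  intro δ hδ
  obtain ⟨R, hR, C, hC, V, hV, hb⟩ := rne_ball hp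
  set ρ := min R (δ / (2 * C / R + 1)) with hρ
  have hρ0 : 0 < ρ := by positivity
  obtain ⟨k, hk, z, hz, y, hy, hyz⟩ := hw (ball p ρ) (ball_mem_nhds p hρ0)
  refine ⟨k, hk, ?_⟩
  have hyR : y ∈ ball p R := ball_subset_ball (min_le_left _ _) hy
  have h1 := (schwarz_bounds (iter_diff f k) hR (hb f (mem_of_mem_nhds hV) k)).2.1 y hyR
  have hy' : ‖y - p‖ < ρ := by simpa [dist_eq_norm] using hy
  have hz' : ‖z - p‖ < ρ := by simpa [dist_eq_norm] using hz
  rw [hyz] at h1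
  have h2 : ρ * (2 * C / R + 1) ≤ δ := by
    rw [← le_div_iff₀ (by positivity)]; exact min_le_right _ _
  calc ‖(eapp f)^[k] p - p‖ = ‖(z - p) - (z - (eapp f)^[k] p)‖ := by congr 1; abel
    _ ≤ ‖z - p‖ + ‖z - (eapp f)^[k] p‖ := norm_sub_le _ _
    _ ≤ ‖z - p‖ + 2 * C / R * ‖y - p‖ := by linarith
    _ ≤ ‖z - p‖ + 2 * C / R * ρ := by gcongr
    _ < ρ + 2 * C / R * ρ := by linarith
    _ ≤ δ := by linarith

lemma rec_large {f : Endo n} {p : Cn n} (hrec : ∀ δ > 0, ∃ k, 1 ≤ k ∧ ‖(eapp f)^[k] p - p‖ < δ)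
    (hnp : ¬ IsPer f p) (N : ℕ) {δ : ℝ} (hδ : 0 < δ) :
    ∃ k, N ≤ k ∧ 1 ≤ k ∧ ‖(eapp f)^[k] p - p‖ < δ := by
  have hfin : (Set.image (fun k => (eapp f)^[k] p) (Set.Icc 1 N)).Finite :=
    (Set.finite_Icc 1 N).image _
  have hmem : (Set.image (fun k => (eapp f)^[k] p) (Set.Icc 1 N))ᶜ ∈ 𝓝 p := by
    apply hfin.isClosed.isOpen_compl.mem_nhds
    rintro ⟨k, hk, e⟩
    exact hnp ⟨k, hk.1, e⟩
  obtain ⟨η, hη, hηs⟩ := Metric.mem_nhds_iff.1 hmem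
  obtain ⟨k, hk, hkd⟩ := hrec (min δ η) (by positivity)
  refine ⟨k, ?_, hk, hkd.trans_le (min_le_left _ _)⟩
  by_contra hc
  have : (eapp f)^[k] p ∈ ball p η := by
    rw [mem_ball, dist_eq_norm]; exact hkd.trans_le (min_le_right _ _)
  exact hηs this ⟨k, ⟨hk, by omega⟩, rfl⟩

/-- Uniform control along the orbit of a recurrent point. -/
lemma orbit_control {f : Endo n} {p : Cn n}
    (hrec : ∀ N : ℕ, ∀ δ : ℝ, 0 < δ → ∃ k, N ≤ k ∧ 1 ≤ k ∧ ‖(eapp f)^[k] p - p‖ < δ)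
    {R C : ℝ} (hR : 0 < R) (hC : 0 < C) (hb : ∀ j : ℕ, ∀ y ∈ ball p R, ‖(eapp f)^[j] y‖ ≤ C) :
    ∃ r > 0, ∃ C' > 0, ∀ i j : ℕ, ∀ y ∈ ball ((eapp f)^[i] p) r, ‖(eapp f)^[j] y‖ ≤ C' := by
  set δ := R / 4 with hδ
  have hδ0 : 0 < δ := by positivity
  set X : Set (Cn n) := closure (Set.range fun i => (eapp f)^[i] p) with hX
  have hpo : ∀ i, ‖(eapp f)^[i] p‖ ≤ C := fun i => hb i p (mem_ball_self hR)
  have hXc : IsCompact X := by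
    apply (isCompact_closedBall (0 : Cn n) C).of_isClosed_subset isClosed_closure
    apply closure_minimal _ isClosed_closedBall
    rintro _ ⟨i, rfl⟩
    simpa using hpo i
  have hYc : IsCompact (X ∩ closedBall p δ) := hXc.inter_right isClosed_closedBall
  have hret : ∀ q ∈ X ∩ closedBall p δ, ∃ s, 1 ≤ s ∧ (eapp f)^[s] q ∈ ball p δ := by
    rintro q ⟨hqX, hqB⟩
    have hbq : ∀ j : ℕ, ∀ y ∈ ball q (R / 2), ‖(eapp f)^[j] y‖ ≤ C := by
      intro j y hy
      apply hb j y
      rw [mem_ball] at hy ⊢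
      rw [mem_closedBall] at hqB
      linarith [dist_triangle y q p]
    set η := min (R / 2) (δ / 2 / (2 * C / (R / 2) + 1)) with hη
    have hη0 : 0 < η := by positivity
    obtain ⟨_, ⟨i, rfl⟩, hi⟩ := Metric.mem_closure_iff.1 hqX η hη0
    obtain ⟨k, hk, hk1, hkd⟩ := hrec (i + 1) (δ / 2) (by positivity)
    refine ⟨k - i, by omega, ?_⟩
    have hi' : (eapp f)^[i] p ∈ ball q (R / 2) := by
      rw [mem_ball, dist_comm]; exact hi.trans_le (min_le_left _ _)
    have h1 := (schwarz_bounds (iter_diff f (k - i)) (by positivity) (hbq (k - i))).2.1 _ hi'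
    rw [← Function.iterate_add_apply, show k - i + i = k by omega] at h1
    simp only [dist_comm q, dist_eq_norm] at hi
    have h2 : (2 * C / (R / 2) + 1) * η ≤ δ / 2 := by
      rw [mul_comm, ← le_div_iff₀ (by positivity)]; exact min_le_right _ _
    have h3 : 2 * C / (R / 2) * ‖(eapp f)^[i] p - q‖ ≤ 2 * C / (R / 2) * η := by gcongr
    rw [mem_ball, dist_eq_norm]
    calc ‖(eapp f)^[k - i] q - p‖
        = ‖((eapp f)^[k] p - p) - ((eapp f)^[k] p - (eapp f)^[k - i] q)‖ := by congr 1; abel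
      _ ≤ ‖(eapp f)^[k] p - p‖ + ‖(eapp f)^[k] p - (eapp f)^[k - i] q‖ := norm_sub_le _ _
      _ < δ := by linarith
  obtain ⟨L, hL⟩ : ∃ L : ℕ, ∀ q ∈ X ∩ closedBall p δ, ∃ s, 1 ≤ s ∧ s ≤ L ∧
      (eapp f)^[s] q ∈ ball p δ := by
    obtain ⟨T, hT⟩ := hYc.elim_finite_subcover
      (fun s : ℕ => ((eapp f)^[s + 1]) ⁻¹' ball p δ)
      (fun s => isOpen_ball.preimage (iter_cont f _)) (by
        intro q hq
        obtain ⟨s, hs, h⟩ := hret q hq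
        refine Set.mem_iUnion.2 ⟨s - 1, ?_⟩
        rw [show s - 1 + 1 = s by omega]; exact h)
    refine ⟨T.sup id + 1, fun q hq => ?_⟩
    obtain ⟨s, hs, h⟩ := Set.mem_iUnion₂.1 (hT hq)
    exact ⟨s + 1, by omega, by have := Finset.le_sup (f := id) hs; simp only [id] at this; omega, h⟩
  have hLi : ∀ i : ℕ, ∃ s ≤ L, (eapp f)^[s + i] p ∈ ball p δ := by
    intro i
    induction i with
    | zero => exact ⟨0, Nat.zero_le _, by simpa using hδ0⟩
    | succ i ih =>
      obtain ⟨s, hs, h⟩ := ih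
      rcases Nat.eq_zero_or_pos s with rfl | hs0
      · rw [zero_add] at h
        obtain ⟨s, hs1, hsL, h'⟩ := hL ((eapp f)^[i] p)
          ⟨subset_closure ⟨i, rfl⟩, ball_subset_closedBall h⟩
        refine ⟨s - 1, by omega, ?_⟩
        rw [← Function.iterate_add_apply] at h'
        rwa [show s - 1 + (i + 1) = s + i by omega]
      · refine ⟨s - 1, by omega, ?_⟩
        rwa [show s - 1 + (i + 1) = s + i by omega]
  -- uniform continuity of finitely many iterates
  have huc : ∀ L : ℕ, ∃ r > 0, r ≤ 1 ∧ ∀ s ≤ L, ∀ x ∈ closedBall (0 : Cn n) (C + 1),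
      ∀ y ∈ closedBall (0 : Cn n) (C + 1), dist x y < r →
        dist ((eapp f)^[s] x) ((eapp f)^[s] y) < δ := by
    intro L
    have h1 : ∀ s, ∃ r > 0, ∀ x ∈ closedBall (0 : Cn n) (C + 1),
      ∀ y ∈ closedBall (0 : Cn n) (C + 1), dist x y < r →
        dist ((eapp f)^[s] x) ((eapp f)^[s] y) < δ := fun s =>
      Metric.uniformContinuousOn_iff.1
        ((isCompact_closedBall (0 : Cn n) (C + 1)).uniformContinuousOn_of_continuous
          (iter_cont f s).continuousOn) δ hδ0
    induction L with
    | zero =>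
      obtain ⟨r, hr, h⟩ := h1 0
      refine ⟨min r 1, by positivity, min_le_right _ _, fun s hs x hx y hy hxy => ?_⟩
      obtain rfl : s = 0 := by omega
      exact h x hx y hy (hxy.trans_le (min_le_left _ _))
    | succ L ih =>
      obtain ⟨r, hr, hr1, h⟩ := ih
      obtain ⟨r', hr', h'⟩ := h1 (L + 1)
      refine ⟨min r r', by positivity, (min_le_left _ _).trans hr1, fun s hs x hx y hy hxy => ?_⟩
      rcases Nat.lt_or_ge s (L + 1) with hlt | hge
      · exact h s (by omega) x hx y hy (hxy.trans_le (min_le_left _ _))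
      · obtain rfl : s = L + 1 := by omega
        exact h' x hx y hy (hxy.trans_le (min_le_right _ _))
  obtain ⟨r, hr, hr1, hru⟩ := huc L
  refine ⟨r, hr, C + δ, by positivity, fun i j y hy => ?_⟩
  have hx1 : (eapp f)^[i] p ∈ closedBall (0 : Cn n) (C + 1) := by
    simp only [mem_closedBall, dist_zero_right]; linarith [hpo i]
  have hy1 : y ∈ closedBall (0 : Cn n) (C + 1) := by
    rw [mem_ball] at hy
    have h2 := dist_triangle y ((eapp f)^[i] p) 0
    have h3 := hpo i
    rw [dist_zero_right ((eapp f)^[i] p)] at h2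
    rw [mem_closedBall]
    linarith
  obtain ⟨s, hs, hsB⟩ := hLi i
  rcases Nat.lt_or_ge j s with hlt | hge
  · have h2 := hru j (by omega) y hy1 _ hx1 hy
    rw [← Function.iterate_add_apply] at h2
    have h3 := hpo (j + i)
    have h4 := dist_triangle ((eapp f)^[j] y) ((eapp f)^[j + i] p) 0
    rw [dist_zero_right, dist_zero_right] at h4
    linarith
  · have h2 := hru s hs y hy1 _ hx1 hy
    rw [← Function.iterate_add_apply] at h2
    have h3 : (eapp f)^[s] y ∈ ball p R := by
      rw [mem_ball] at hsB ⊢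
      have := dist_triangle ((eapp f)^[s] y) ((eapp f)^[s + i] p) p
      linarith
    have h4 := hb (j - s) _ h3
    rw [← Function.iterate_add_apply, show j - s + s = j by omega] at h4
    linarith

lemma rec_rne_per {f : Endo n} {p : Cn n} (hp : p ∈ rne f)
    (hrec₀ : ∀ δ > 0, ∃ k, 1 ≤ k ∧ ‖(eapp f)^[k] p - p‖ < δ) : IsPer f p := by
  by_contra hnp
  have hrec := fun N : ℕ => fun δ : ℝ => fun hδ : 0 < δ => rec_large hrec₀ hnp N hδ
  obtain ⟨R, hR, C, hC, V, hV, hb⟩ := rne_ball hp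
  obtain ⟨r, hr, C', hC', hr'⟩ := orbit_control hrec hR hC (hb f (mem_of_mem_nhds hV))
  set P : ℕ → Cn n := fun i => (eapp f)^[i] p with hPdef
  have hPadd : ∀ s i, (eapp f)^[s] (P i) = P (s + i) := fun s i =>
    (Function.iterate_add_apply _ _ _ _).symm
  set Λ₁ := 2 * C' / r with hΛ₁
  set Λ₂ := 4 * C' / r ^ 2 with hΛ₂
  have hΛ₁0 : 0 < Λ₁ := by positivity
  have hΛ₂0 : 0 < Λ₂ := by positivity
  have hs1 : ∀ i j y, y ∈ ball (P i) r → ‖(eapp f)^[j] y - P (j + i)‖ ≤ Λ₁ * ‖y - P i‖ := by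
    intro i j y hy
    have := (schwarz_bounds (iter_diff f j) hr (hr' i j)).2.1 y hy
    rwa [hPadd] at this
  have hs2 : ∀ i j y, y ∈ ball (P i) r → ‖(eapp f)^[j] y - P (j + i) -
      fderiv ℂ ((eapp f)^[j]) (P i) (y - P i)‖ ≤ Λ₂ * ‖y - P i‖ ^ 2 := by
    intro i j y hy
    have := (schwarz_bounds (iter_diff f j) hr (hr' i j)).2.2 y hy
    rwa [hPadd] at this
  obtain ⟨k, -, hk1, hkd⟩ := hrec 0 (min r (min (r / Λ₁) (1 / (4 * Λ₂ * Λ₁ ^ 2)))) (by positivity)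
  set c := ‖P k - P 0‖ with hc
  have hkd : c < min r (min (r / Λ₁) (1 / (4 * Λ₂ * Λ₁ ^ 2))) := hkd
  have hc0 : 0 < c := by
    rw [hc, norm_pos_iff, sub_ne_zero]
    exact fun e => hnp ⟨k, hk1, e⟩
  have hcr : c < r := hkd.trans_le (min_le_left _ _)
  have hcr1 : Λ₁ * c < r := by
    have := hkd.trans_le ((min_le_right _ _).trans (min_le_left _ _))
    rwa [lt_div_iff₀ hΛ₁0, mul_comm] at this
  have hcr2 : Λ₂ * (Λ₁ * c) ^ 2 ≤ c / 4 := by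
    have := (hkd.trans_le ((min_le_right _ _).trans (min_le_right _ _))).le
    rw [le_div_iff₀ (by positivity)] at this
    nlinarith
  set W : Cn n → Cn n := fun z => (eapp f)^[k] z - z with hWdef
  have hW : Differentiable ℂ W := (iter_diff f k).sub differentiable_id
  set d : ℕ → Cn n := fun i => W (P i) with hd
  have hd' : ∀ i, d i = P (i + k) - P i := by
    intro i
    simp only [hd, hWdef]
    rw [hPadd, add_comm]
  have hdc : ∀ i, ‖d i‖ ≤ Λ₁ * c := by
    intro i
    have := hs1 0 i (P k) (by rw [mem_ball, dist_eq_norm]; exact hcr)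
    rw [hPadd] at this
    rw [hd']
    exact this
  have hest : ∀ i s, ‖fderiv ℂ ((eapp f)^[s]) (P i) (d i) - d (s + i)‖ ≤ c / 4 := by
    intro i s
    have h1 := hs2 i s (P (i + k)) (by
      rw [mem_ball, dist_eq_norm, ← hd']; exact (hdc i).trans_lt hcr1)
    rw [← hd', hPadd, ← add_assoc, ← hd', norm_sub_rev] at h1
    refine h1.trans (le_trans ?_ hcr2)
    gcongr
    exact hdc i
  obtain ⟨ε, hε, hεV⟩ := pert_close f W hW hV
  set Φ : ℕ → ℂ → Cn n := fun j t => (eapp (pert f W hW t))^[j] p with hΦ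
  have hΦs : ∀ j t, Φ (j + 1) t = eapp f (Φ j t + t • W (Φ j t)) := by
    intro j t
    simp only [hΦ]
    rw [Function.iterate_succ_apply', pert_apply]
  have hfd := eapp_diff f
  have hΦd : ∀ j, Differentiable ℂ (Φ j) := by
    intro j
    induction j with
    | zero => exact differentiable_const p
    | succ j ih =>
      have : Φ (j + 1) = fun t => eapp f (Φ j t + t • W (Φ j t)) := funext (hΦs j)
      rw [this]
      exact hfd.comp (ih.add (differentiable_id.smul (hW.comp ih)))
  have hΦ0 : ∀ j, Φ j 0 = P j := by
    intro j
    induction j with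
    | zero => rfl
    | succ j ih =>
      rw [hΦs, ih, zero_smul, add_zero]
      exact (Function.iterate_succ_apply' _ _ _).symm
  set D : ℕ → Cn n := fun j => ∑ i ∈ Finset.range j,
    fderiv ℂ ((eapp f)^[j - i]) (P i) (d i) with hD
  have hDs : ∀ j, D (j + 1) = fderiv ℂ (eapp f) (P j) (D j + d j) := by
    intro j
    simp only [hD]
    rw [Finset.sum_range_succ, map_add, map_sum]
    congr 1
    · apply Finset.sum_congr rfl
      intro i hi
      have hi := Finset.mem_range.1 hi
      rw [show j + 1 - i = (j - i) + 1 by omega, Function.iterate_succ',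
        fderiv_comp _ (hfd _) (iter_diff f _ _), hPadd, show j - i + i = j by omega]
      rfl
    · rw [show j + 1 - j = 1 by omega, Function.iterate_one]
  have hΦD : ∀ j, HasDerivAt (Φ j) (D j) 0 := by
    intro j
    induction j with
    | zero => simpa [hD, hΦ] using hasDerivAt_const (0 : ℂ) p
    | succ j ih =>
      have e : Φ (j + 1) = fun t => eapp f (Φ j t + t • W (Φ j t)) := funext (hΦs j)
      rw [e, hDs]
      have h1 : HasDerivAt (fun t : ℂ => W (Φ j t)) (fderiv ℂ W (Φ j 0) (D j)) 0 :=
        (hW (Φ j 0)).hasFDerivAt.comp_hasDerivAt 0 ih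
      have h2 := ih.add ((hasDerivAt_id (0 : ℂ)).smul h1)
      have h3 : HasDerivAt (fun t : ℂ => Φ j t + t • W (Φ j t)) (D j + d j) 0 := by
        refine h2.congr_deriv ?_
        simp [hΦ0, hd]
      have h4 : HasFDerivAt (eapp f) (fderiv ℂ (eapp f) (P j)) (Φ j 0 + (0 : ℂ) • W (Φ j 0)) := by
        rw [zero_smul, add_zero, hΦ0]; exact (hfd _).hasFDerivAt
      exact h4.comp_hasDerivAt 0 h3
  have hDb : ∀ j, ‖D j‖ ≤ 2 * C / ε := by
    intro j
    have hm : ∀ t ∈ ball (0 : ℂ) ε, ‖Φ j t‖ ≤ C := by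
      intro t ht
      exact hb _ (hεV t (by simpa using ht)) j p (mem_ball_self hR)
    have hmt : Set.MapsTo (Φ j) (ball (0 : ℂ) ε) (closedBall (Φ j 0) (2 * C)) := by
      intro t ht
      rw [mem_closedBall, dist_eq_norm]
      have h0 := hm 0 (mem_ball_self hε)
      exact (norm_sub_le _ _).trans (by linarith [hm t ht])
    have := Complex.norm_deriv_le_div_of_mapsTo_ball (hΦd j).differentiableOn hmt hε
    rwa [(hΦD j).deriv] at this
  have hDj : ∀ j : ℕ, ‖D j - (j : ℂ) • d j‖ ≤ j * (c / 4) := by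
    intro j
    have : D j - (j : ℂ) • d j = ∑ i ∈ Finset.range j,
        (fderiv ℂ ((eapp f)^[j - i]) (P i) (d i) - d j) := by
      rw [Finset.sum_sub_distrib, Finset.sum_const, Finset.card_range, Nat.cast_smul_eq_nsmul]
    rw [this]
    refine (norm_sum_le_of_le _ (f := fun i => _) (n := fun _ => c / 4) ?_).trans ?_
    · intro i hi
      have hi := Finset.mem_range.1 hi
      have h1 := hest i (j - i)
      rwa [show j - i + i = j by omega] at h1
    · simp
  obtain ⟨δ, hδ, hδW⟩ := Metric.continuous_iff.1 hW.continuous p (c / 2) (by positivity)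
  obtain ⟨N, hN⟩ := exists_nat_gt (2 * C / ε / (c / 4))
  obtain ⟨M, hNM, -, hMd⟩ := hrec N δ hδ
  have h1 := hδW (P M) (by rw [dist_eq_norm]; exact hMd)
  have h2 : c / 2 ≤ ‖d M‖ := by
    have e0 : W p = P k - P 0 := rfl
    have h3 : ‖W p‖ = c := by rw [e0]
    rw [dist_comm, dist_eq_norm] at h1
    have h4 := norm_sub_norm_le (W p) (W (P M))
    simp only [hd]
    linarith
  have h3 : (M : ℝ) * (c / 2) ≤ ‖(M : ℂ) • d M‖ := by
    rw [norm_smul, Complex.norm_natCast]; gcongr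
  have h4 := norm_sub_norm_le ((M : ℂ) • d M) (D M)
  rw [norm_sub_rev] at h4
  have h5 : (N : ℝ) ≤ M := by exact_mod_cast hNM
  rw [div_lt_iff₀ (by positivity)] at hN
  have h6 : (N : ℝ) * (c / 4) ≤ M * (c / 4) := by gcongr
  linarith [hDj M, hDb M]

/-! ### Normality on the robustly non-expelling set -/

lemma rne_subset_Fatou {f : Endo n} {p : Cn n} (hp : p ∈ rne f) : FatouAt f p := by
  obtain ⟨R, hR, C, hC, V, hV, hb⟩ := rne_ball hp
  have hb := hb f (mem_of_mem_nhds hV)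
  set ρ := R / 2 with hρ
  have hρ0 : 0 < ρ := by positivity
  have hbx : ∀ x ∈ closedBall p ρ, ∀ j : ℕ, ∀ y ∈ ball x ρ, ‖(eapp f)^[j] y‖ ≤ C := by
    intro x hx j y hy
    apply hb
    rw [mem_closedBall] at hx
    rw [mem_ball] at hy ⊢
    linarith [dist_triangle y x p]
  have hsch := fun x (hx : x ∈ closedBall p ρ) j =>
    schwarz_bounds (iter_diff f j) hρ0 (hbx x hx j)
  refine ⟨ball p ρ, isOpen_ball, mem_ball_self hρ0, fun k hk => ?_⟩
  haveI : CompactSpace (closedBall p ρ) := isCompact_iff_compactSpace.1 (isCompact_closedBall p ρ)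
  let Fm : ℕ → BoundedContinuousFunction (closedBall p ρ) (Cn n) := fun m =>
    BoundedContinuousFunction.mkOfCompact
      ⟨fun x => (eapp f)^[m] x.1, (iter_cont f m).comp continuous_subtype_val⟩
  have hFm : ∀ m x, Fm m x = (eapp f)^[m] x.1 := fun m x => rfl
  have hcomp : IsCompact (closure (Set.range Fm)) := by
    apply BoundedContinuousFunction.arzela_ascoli (closedBall (0 : Cn n) C)
      (isCompact_closedBall _ _)
    · rintro _ x ⟨m, rfl⟩
      rw [hFm]
      have := hbx x.1 x.2 m x.1 (mem_ball_self hρ0)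
      simpa using this
    · intro x
      rw [Metric.equicontinuousAt_iff]
      intro ε hε
      refine ⟨min ρ (ε / (2 * C / ρ + 1)), by positivity, fun y hy => ?_⟩
      rintro ⟨_, m, rfl⟩
      show dist (Fm m x) (Fm m y) < ε
      rw [hFm, hFm, dist_comm, dist_eq_norm]
      have hy1 : y.1 ∈ ball x.1 ρ := by
        rw [mem_ball]; exact hy.trans_le (min_le_left _ _)
      have hy2 : ‖y.1 - x.1‖ < ε / (2 * C / ρ + 1) := by
        rw [← dist_eq_norm]; exact hy.trans_le (min_le_right _ _)
      rw [lt_div_iff₀ (by positivity)] at hy2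
      have h1 := (hsch x.1 x.2 m).2.1 y.1 hy1
      nlinarith [norm_nonneg (y.1 - x.1)]
  obtain ⟨G, -, l, hl, hlim⟩ := hcomp.tendsto_subseq
    (x := fun j => Fm (k j)) (fun j => subset_closure ⟨k j, rfl⟩)
  refine ⟨l, hl, Or.inl ?_⟩
  classical
  let g : Cn n → Cn n := fun z => if h : z ∈ closedBall p ρ then G ⟨z, h⟩ else 0
  have hg : ∀ z (h : z ∈ closedBall p ρ), g z = G ⟨z, h⟩ := fun z h => dif_pos h
  have hunif : TendstoUniformlyOn (fun j => (eapp f)^[k (l j)]) g atTop (closedBall p ρ) := by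
    rw [Metric.tendstoUniformlyOn_iff]
    intro ε hε
    have := Metric.tendstoUniformly_iff.1
      (BoundedContinuousFunction.tendsto_iff_tendstoUniformly.1 hlim) ε hε
    filter_upwards [this] with j hj x hx
    rw [hg x hx]
    exact hj ⟨x, hx⟩
  have hpt : ∀ x ∈ closedBall p ρ, Tendsto (fun j => (eapp f)^[k (l j)] x) atTop (𝓝 (g x)) :=
    fun x hx => hunif.tendsto_at hx
  refine ⟨g, ?_, (hunif.mono ball_subset_closedBall).tendstoLocallyUniformlyOn⟩
  intro x hx
  have hx' := ball_subset_closedBall hx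
  haveI : ProperSpace (Cn n →L[ℂ] Cn n) := FiniteDimensional.proper ℂ _
  obtain ⟨A, -, s, hs, hA⟩ := (isCompact_closedBall (0 : Cn n →L[ℂ] Cn n) (2 * C / ρ)).tendsto_subseq
    (x := fun j => fderiv ℂ ((eapp f)^[k (l j)]) x) (fun j => by
      simpa using (hsch x hx' (k (l j))).1)
  have hest : ∀ y ∈ closedBall p ρ, y ∈ ball x ρ →
      ‖g y - g x - A (y - x)‖ ≤ 4 * C / ρ ^ 2 * ‖y - x‖ ^ 2 := by
    intro y hy hyx
    have h1 := (hpt y hy).comp hs.tendsto_atTop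
    have h2 := (hpt x hx').comp hs.tendsto_atTop
    have h3 : Tendsto (fun j => (fderiv ℂ ((eapp f)^[k (l (s j))]) x) (y - x)) atTop
        (𝓝 (A (y - x))) :=
      ((ContinuousLinearMap.apply ℂ (Cn n) (y - x)).continuous.tendsto A).comp hA
    refine le_of_tendsto ((h1.sub h2).sub h3).norm (Eventually.of_forall fun j => ?_)
    exact (hsch x hx' (k (l (s j)))).2.2 y hyx
  have hder : HasFDerivAt g A x := by
    rw [hasFDerivAt_iff_isLittleO]
    have h1 : (fun y => g y - g x - A (y - x)) =O[𝓝 x] fun y => ‖y - x‖ ^ 2 := by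
      refine Asymptotics.IsBigO.of_bound (4 * C / ρ ^ 2) ?_
      filter_upwards [isOpen_ball.mem_nhds hx, ball_mem_nhds x hρ0] with y hy1 hy2
      simpa using hest y (ball_subset_closedBall hy1) hy2
    refine h1.trans_isLittleO ?_
    have h2 := (Asymptotics.isLittleO_pow_id (𝕜 := ℝ) (n := 2) (by norm_num))
    have h3 : Tendsto (fun y : Cn n => ‖y - x‖) (𝓝 x) (𝓝 0) := by
      have : Continuous fun y : Cn n => ‖y - x‖ := by fun_prop
      simpa using this.tendsto x
    exact (h2.comp_tendsto h3).trans_isBigO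
      (Asymptotics.IsBigO.of_bound 1 (by simp))
  exact hder.differentiableAt.differentiableWithinAt

/-! ### Genericity -/

lemma residual_of_isOpen {X : Type*} [TopologicalSpace X] {O : Set X} (hO : IsOpen O) :
    ∀ᶠ x in residual X, x ∈ closure O → x ∈ O := by
  have h : O ∪ (closure O)ᶜ ∈ residual X := by
    apply residual_of_dense_open (hO.union isClosed_closure.isOpen_compl)
    intro x
    by_cases hx : x ∈ closure O
    · exact closure_mono Set.subset_union_left hx
    · exact subset_closure (Or.inr hx)
  filter_upwards [h] with x hx hxc
  rcases hx with h | h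
  · exact h
  · exact absurd hxc h

def AttIn (b : Set (Cn n)) : Set (Endo n) := {g | ∃ q ∈ b, StrongAtt g q}

def EscIn (b : Set (Cn n)) (N : ℕ) : Set (Endo n) := {g | ∃ x ∈ b, ∃ j : ℕ, N < ‖(eapp g)^[j] x‖}

lemma attIn_open {b : Set (Cn n)} (hb : IsOpen b) : IsOpen (AttIn b) := by
  rw [isOpen_iff_mem_nhds]
  rintro g ⟨q, hq, hs⟩
  exact hs.robust (hb.mem_nhds hq)

lemma escIn_open (b : Set (Cn n)) (N : ℕ) : IsOpen (EscIn b N) := by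
  have : EscIn b N = ⋃ x ∈ b, ⋃ j : ℕ, {g : Endo n | N < ‖(eapp g)^[j] x‖} := by
    ext g; simp [EscIn]
  rw [this]
  refine isOpen_biUnion fun x _ => isOpen_iUnion fun j => ?_
  have hc : Continuous fun g : Endo n => (eapp g)^[j] x :=
    (continuous_eval_const x).comp (continuous_iterEndo j)
  exact isOpen_lt continuous_const hc.norm

def Good (f : Endo n) : Prop := ∀ b ∈ TopologicalSpace.countableBasis (Cn n),
  (f ∈ closure (AttIn b) → f ∈ AttIn b) ∧ ∀ N, f ∈ closure (EscIn b N) → f ∈ EscIn b N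

lemma good_residual : ∀ᶠ f in residual (Endo n), Good f := by
  have hc := TopologicalSpace.countable_countableBasis (Cn n)
  have := (eventually_countable_ball hc (l := residual (Endo n))
    (p := fun f b _ => (f ∈ closure (AttIn b) → f ∈ AttIn b) ∧
      ∀ N, f ∈ closure (EscIn b N) → f ∈ EscIn b N)).2 (by
    intro b hb
    refine (residual_of_isOpen (attIn_open (TopologicalSpace.isOpen_of_mem_countableBasis hb))).and ?_
    rw [eventually_countable_forall]
    intro N
    exact residual_of_isOpen (escIn_open b N))
  exact this

lemma exists_basis {p : Cn n} {U : Set (Cn n)} (hU : U ∈ 𝓝 p) :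
    ∃ b ∈ TopologicalSpace.countableBasis (Cn n), p ∈ b ∧ b ⊆ U :=
  (TopologicalSpace.isBasis_countableBasis (Cn n)).mem_nhds_iff.1 hU

lemma good_closure {f : Endo n} (hf : Good f) {p : Cn n}
    (h : ∀ U ∈ 𝓝 p, ∀ V ∈ 𝓝 f, ∃ g ∈ V, ∃ q ∈ U, StrongAtt g q) :
    p ∈ closure {q | StrongAtt f q} := by
  rw [mem_closure_iff_nhds]
  intro U hU
  obtain ⟨b, hb, hpb, hbU⟩ := exists_basis hU
  obtain ⟨q, hq, hs⟩ := (hf b hb).1 (by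
    rw [mem_closure_iff_nhds]
    intro V hV
    obtain ⟨g, hg, q, hq, hs⟩ := h b
      ((TopologicalSpace.isOpen_of_mem_countableBasis hb).mem_nhds hpb) V hV
    exact ⟨g, hg, q, hq, hs⟩)
  exact ⟨q, hbU hq, hs⟩

lemma good_not_rne {f : Endo n} (hf : Good f) {p : Cn n} (hp : p ∉ rne f) :
    p ∈ closure {q | StrongAtt f q} :=
  good_closure hf fun _ hU _ hV => escape hp hU hV

lemma good_clo {f : Endo n} (hf : Good f) {p : Cn n} (hp : p ∈ cloSet f) :
    p ∈ closure {q | StrongAtt f q} := by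
  by_cases hr : p ∈ rne f
  · refine good_closure hf fun U hU V hV => ?_
    obtain ⟨U₀, hU₀, hpU₀, V₀, hV₀, K, hK, hb⟩ := hr
    obtain ⟨g, hg, q, hq, hper⟩ := hp (U ∩ U₀) (inter_mem hU (hU₀.mem_nhds hpU₀))
      (V ∩ interior V₀) (inter_mem hV (interior_mem_nhds.2 hV₀))
    refine ⟨g, hg.1, q, hq.1, per_rne hper ⟨U₀, hU₀, hq.2, V₀, mem_interior_iff_mem_nhds.1 hg.2, K, hK, hb⟩⟩
  · exact good_not_rne hf hr

lemma nonWandering_rne {f : Endo n} {p : Cn n} (hw : p ∈ nonWandering f) (hp : p ∈ rne f) :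
    StrongAtt f p := per_rne (rec_rne_per hp (nonWandering_rec hw hp)) hp

lemma closure_att_nonWandering {f : Endo n} : closure (attSet f) ⊆ nonWandering f := by
  intro p hp U hU
  obtain ⟨q, hqU, ⟨m, hm, hq⟩, -⟩ := mem_closure_iff_nhds.1 hp U hU
  exact ⟨m, hm, q, hqU, q, hqU, hq⟩

lemma closure_att_clo {f : Endo n} : closure (attSet f) ⊆ cloSet f := by
  intro p hp U hU V hV
  obtain ⟨q, hqU, hq, -⟩ := mem_closure_iff_nhds.1 hp U hU
  exact ⟨f, mem_of_mem_nhds hV, q, hqU, hq⟩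

lemma good_esc {f : Endo n} (hf : Good f) {p : Cn n} (hp : p ∉ rne f) {ρ : ℝ} (hρ : 0 < ρ)
    (N : ℕ) : ∃ x ∈ ball p ρ, ∃ j : ℕ, N < ‖(eapp f)^[j] x‖ := by
  obtain ⟨b, hb, hpb, hbU⟩ := exists_basis (ball_mem_nhds p hρ)
  obtain ⟨x, hx, j, hj⟩ := (hf b hb).2 N (by
    by_contra hc
    have hV : (closure (EscIn b N))ᶜ ∈ 𝓝 f := isClosed_closure.isOpen_compl.mem_nhds hc
    apply hp
    refine ⟨b, TopologicalSpace.isOpen_of_mem_countableBasis hb, hpb, _, hV, closedBall 0 N,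
      isCompact_closedBall _ _, fun g hg j => ?_⟩
    rintro _ ⟨y, hy, rfl⟩
    rw [mem_closedBall, dist_zero_right]
    by_contra hlt
    exact hg (subset_closure ⟨y, hy, j, not_le.1 hlt⟩))
  exact ⟨x, hbU hx, j, hj⟩

lemma good_esc_late {f : Endo n} (hf : Good f) {p : Cn n} (hp : p ∉ rne f) {ρ : ℝ} (hρ : 0 < ρ)
    (N a : ℕ) : ∃ j ≥ a, ∃ x ∈ closedBall p ρ, N < ‖(eapp f)^[j] x‖ := by
  have hbd : ∀ a : ℕ, ∃ B : ℕ, ∀ j < a, ∀ x ∈ closedBall p ρ, ‖(eapp f)^[j] x‖ ≤ B := by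
    intro a
    induction a with
    | zero => exact ⟨0, fun j hj => absurd hj (by omega)⟩
    | succ a ih =>
      obtain ⟨B, hB⟩ := ih
      obtain ⟨B', hB'⟩ := (isCompact_closedBall p ρ).exists_bound_of_continuousOn
        (iter_cont f a).continuousOn
      obtain ⟨B'', hB''⟩ := exists_nat_ge B'
      refine ⟨max B B'', fun j hj x hx => ?_⟩
      rw [Nat.cast_max]
      rcases Nat.lt_or_ge j a with h | h
      · exact (hB j h x hx).trans (le_max_left _ _)
      · obtain rfl : j = a := by omega
        exact ((hB' x hx).trans hB'').trans (le_max_right _ _)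
  obtain ⟨B, hB⟩ := hbd a
  obtain ⟨x, hx, j, hj⟩ := good_esc hf hp hρ (max N B)
  rw [Nat.cast_max] at hj
  refine ⟨j, ?_, x, ball_subset_closedBall hx, (le_max_left _ _).trans_lt hj⟩
  by_contra hlt
  have := hB j (by omega) x (ball_subset_closedBall hx)
  linarith [(le_max_right (N : ℝ) B).trans_lt hj]

lemma good_Fatou {f : Endo n} (hf : Good f) {p : Cn n} (hp : FatouAt f p) : p ∈ rne f := by
  by_contra hr
  obtain ⟨U, hU, hpU, h⟩ := hp
  obtain ⟨ρ, hρ, hρU⟩ := Metric.nhds_basis_closedBall.mem_iff.1 (hU.mem_nhds hpU)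
  obtain ⟨φ, hφ, hφe⟩ := extraction_forall_of_frequently
    (P := fun N j => ∃ x ∈ closedBall p ρ, (N : ℝ) < ‖(eapp f)^[j] x‖) (fun N => by
      rw [frequently_atTop]
      intro a
      exact good_esc_late hf hr hρ N a)
  obtain ⟨l, hl, h⟩ := h φ hφ
  rcases h with ⟨g, hg, hlim⟩ | hdiv
  · have hu := (tendstoLocallyUniformlyOn_iff_forall_isCompact hU).1 hlim _ hρU
      (isCompact_closedBall p ρ)
    obtain ⟨B, hB⟩ := (isCompact_closedBall p ρ).exists_bound_of_continuousOn
      (hg.continuousOn.mono hρU)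
    obtain ⟨B', hB'⟩ := exists_nat_ge (B + 1)
    obtain ⟨j, hj, hjB⟩ := ((Metric.tendstoUniformlyOn_iff.1 hu 1 one_pos).and
      (eventually_ge_atTop B')).exists
    obtain ⟨x, hx, hxe⟩ := hφe (l j)
    have h1 := hj x hx
    rw [dist_eq_norm, norm_sub_rev] at h1
    have h2 := norm_sub_norm_le ((eapp f)^[φ (l j)] x) (g x)
    have h3 : (B' : ℝ) ≤ l j := by exact_mod_cast hjB.trans (hl.id_le j)
    linarith [hB x hx]
  · obtain ⟨q, hqU, hq⟩ := mem_closure_iff_nhds.1 (good_not_rne hf hr) U (hU.mem_nhds hpU)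
    obtain ⟨R, hR, C, hC, V, hV, hb⟩ := rne_ball (StrongAtt.mem_rne hq)
    obtain ⟨j, hj⟩ := (hdiv {q} (by simpa using hqU) isCompact_singleton (closedBall 0 C)
      (isCompact_closedBall _ _)).exists
    refine Set.disjoint_left.1 hj ⟨q, rfl, rfl⟩ ?_
    simpa using hb f (mem_of_mem_nhds hV) (φ (l j)) q (mem_ball_self hR)

lemma good_main {f : Endo n} (hf : Good f) :
    cloSet f = nonWandering f ∧ nonWandering f = closure (attSet f) ∧
      closure (attSet f) = Julia f ∪ attSet f ∧ Julia f = (rne f)ᶜ ∧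
      interior (Julia f) = ∅ := by
  have hS : closure {q | StrongAtt f q} ⊆ closure (attSet f) :=
    closure_mono fun q hq => StrongAtt.isAtt hq
  have h1 : cloSet f = closure (attSet f) :=
    Set.Subset.antisymm (fun p hp => hS (good_clo hf hp)) closure_att_clo
  have h2 : nonWandering f = closure (attSet f) := by
    refine Set.Subset.antisymm (fun p hp => hS ?_) closure_att_nonWandering
    by_cases hr : p ∈ rne f
    · exact subset_closure (nonWandering_rne hp hr)
    · exact good_not_rne hf hr
  have h3 : Julia f = (rne f)ᶜ := by
    have : Fatou f = rne f :=
      Set.Subset.antisymm (fun p hp => good_Fatou hf hp) (fun p hp => rne_subset_Fatou hp)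
    rw [Julia, this]
  refine ⟨h1.trans h2.symm, h2, ?_, h3, ?_⟩
  · rw [h3]
    apply Set.Subset.antisymm
    · intro p hp
      by_cases hr : p ∈ rne f
      · exact Or.inr (nonWandering_rne (closure_att_nonWandering hp) hr).isAtt
      · exact Or.inl hr
    · rintro p (hp | hp)
      · exact hS (good_not_rne hf hp)
      · exact subset_closure hp
  · rw [h3]
    by_contra hne
    obtain ⟨p, hp⟩ := Set.nonempty_iff_ne_empty.2 hne
    obtain ⟨q, hqI, hq⟩ := mem_closure_iff_nhds.1 (good_not_rne hf (interior_subset hp)) _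
      (isOpen_interior.mem_nhds hp)
    exact interior_subset hqI (StrongAtt.mem_rne hq)

/-- For a generic endomorphism `f` of `ℂⁿ`:
`clo(f) = Ω_f = closure(att(f)) = J_f ∪ att(f)`, `J_f = ℂⁿ \\ rne(f)`, and `J_f` has
empty interior. -/
theorem stmt_12 (n : ℕ) (hn : 1 ≤ n) :
    {f : Endo n | cloSet f = nonWandering f ∧ nonWandering f = closure (attSet f) ∧
      closure (attSet f) = Julia f ∪ attSet f ∧ Julia f = (rne f)ᶜ ∧
      interior (Julia f) = ∅} ∈ residual (Endo n) := by
  exact good_residual.mono fun f hf => good_main hf
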